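/- Let H be a finite subgroup of odd order of the special unitary group SU(3) (unitary 3×3 complex matrices of determinant 1). Then H acts freely and smoothly on S¹¹ × S¹¹: there exists a group homomorphism ρ from H to the group of diffeomorphisms of S¹¹ × S¹¹ such that ρ(g)(x) ≠ x for every g ≠ 1 and every point x. -/

import Mathlib

open scoped Manifold
open Module

noncomputable section

instance : Fact (finrank ℝ (EuclideanSpace ℝ (Fin 12)) = 11 + 1) :=
  ⟨by rw [finrank_euclideanSpace_fin]⟩

open scoped InnerProductSpace

section InvariantComplexStructure

variable {G W : Type} [Group G] [NormedAddCommGroup W] [InnerProductSpace ℝ W]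
  [FiniteDimensional ℝ W]

theorem exists_skew_commuting [Fintype G] (hodd : Odd (Nat.card G)) (ρ : Representation ℝ G W)
    (hρ : ∀ g x y, ⟪ρ g x, ρ g y⟫_ℝ = ⟪x, y⟫_ℝ) (hW : 2 ≤ finrank ℝ W) :
    ∃ A : W →ₗ[ℝ] W, A ≠ 0 ∧ (∀ x y, ⟪A x, y⟫_ℝ = -⟪x, A y⟫_ℝ) ∧
      ∀ g x, A (ρ g x) = ρ g (A x) := by
  classical
  let A : W → W → W →ₗ[ℝ] W := fun a b =>
    ∑ g, ((innerₛₗ ℝ (ρ g b)).smulRight (ρ g a) - (innerₛₗ ℝ (ρ g a)).smulRight (ρ g b))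
  have hA : ∀ a b x, A a b x = ∑ g, (⟪ρ g b, x⟫_ℝ • ρ g a - ⟪ρ g a, x⟫_ℝ • ρ g b) := by
    intro a b x
    simp [A, LinearMap.sum_apply]
  have hskew : ∀ a b x y, ⟪A a b x, y⟫_ℝ = -⟪x, A a b y⟫_ℝ := by
    intro a b x y
    rw [hA, hA, sum_inner, inner_sum, ← Finset.sum_neg_distrib]
    refine Finset.sum_congr rfl fun g _ => ?_
    simp only [inner_sub_left, inner_sub_right, real_inner_smul_left, real_inner_smul_right,
      real_inner_comm x]
    ring
  have hcomm : ∀ a b g x, A a b (ρ g x) = ρ g (A a b x) := by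
    intro a b g x
    rw [hA, hA, map_sum]
    refine Fintype.sum_equiv (Equiv.mulLeft g⁻¹) _ _ fun k => ?_
    have h1 : ∀ z, ρ k z = ρ g (ρ (g⁻¹ * k) z) := fun z => by
      rw [← Module.End.mul_apply, ← map_mul]; simp
    simp only [Equiv.coe_mulLeft, map_sub, map_smul]
    rw [h1 a, h1 b, hρ, hρ]
  by_contra hno
  push Not at hno
  have hzero : ∀ a b, A a b = 0 := by
    intro a b
    by_contra h
    obtain ⟨g, x, hgx⟩ := hno _ h (hskew a b)
    exact hgx (hcomm a b g x)
  let e := stdOrthonormalBasis ℝ W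
  let f : G → ℝ := fun g => LinearMap.trace ℝ W (ρ g)
  have hf : ∀ g, f g = ∑ i, ⟪e i, ρ g (e i)⟫_ℝ := fun g => LinearMap.trace_eq_sum_inner _ e
  have hsq : ∑ g, f (g * g) = ∑ g, f g ^ 2 := by
    have h1 : ∀ i j, ∑ g, ⟪e i, ρ g (e j)⟫_ℝ * ⟪e j, ρ g (e i)⟫_ℝ =
        ∑ g, ⟪e i, ρ g (e i)⟫_ℝ * ⟪e j, ρ g (e j)⟫_ℝ := by
      intro i j
      have h2 := congrArg (fun z => ⟪e i, z⟫_ℝ) (LinearMap.congr_fun (hzero (e j) (e i)) (e j))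
      simp only [hA, inner_sum, LinearMap.zero_apply, inner_zero_right, inner_sub_right,
        real_inner_smul_right, Finset.sum_sub_distrib] at h2
      rw [sub_eq_zero] at h2
      calc _ = ∑ g, ⟪ρ g (e i), e j⟫_ℝ * ⟪e i, ρ g (e j)⟫_ℝ := by
            refine Finset.sum_congr rfl fun g _ => ?_
            rw [real_inner_comm (e j), mul_comm]
        _ = _ := h2.trans (by
            refine Finset.sum_congr rfl fun g _ => ?_
            rw [real_inner_comm (e j), mul_comm])
    have h3 : ∀ g, f (g * g) = ∑ i, ∑ j, ⟪e i, ρ g (e j)⟫_ℝ * ⟪e j, ρ g (e i)⟫_ℝ := by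
      intro g
      rw [hf]
      refine Finset.sum_congr rfl fun i _ => ?_
      have h4 := fun x => hρ g⁻¹ (e i) (ρ g x)
      have h5 : ∀ x, ρ g⁻¹ (ρ g x) = x := fun x => by
        rw [← Module.End.mul_apply, ← map_mul]; simp
      simp only [h5] at h4
      simp only [← h4]
      rw [map_mul, Module.End.mul_apply, ← h4, ← e.sum_inner_mul_inner]
    simp only [h3, hf, sq, Finset.sum_mul_sum]
    rw [Finset.sum_comm]
    conv_rhs => rw [Finset.sum_comm]
    refine Finset.sum_congr rfl fun i _ => ?_
    rw [Finset.sum_comm]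
    conv_rhs => rw [Finset.sum_comm]
    exact Finset.sum_congr rfl fun j _ => h1 i j
  have hbij : ∑ g, f (g * g) = ∑ g, f g := by
    have hb : Function.Bijective fun g : G => g * g := by
      have := (powCoprime (G := G) (n := 2) (Nat.coprime_two_right.mpr hodd)).bijective
      simpa [powCoprime, sq] using this
    exact hb.sum_comp f
  obtain ⟨N, hN⟩ : ∃ N : ℝ, N = (Fintype.card G : ℝ) := ⟨_, rfl⟩
  have hNpos : 0 < N := by simp [hN, Fintype.card_pos]
  let _ : Invertible (Fintype.card G : ℝ) := invertibleOfNonzero (hN ▸ hNpos.ne')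
  have htr : ∑ g, f g = N * finrank ℝ ρ.invariants := by
    have h1 := (ρ.isProj_averageMap).trace
    have h2 : ρ.averageMap = (⅟ (Fintype.card G : ℝ)) • ∑ g, ρ g := by
      simp [Representation.averageMap, GroupAlgebra.average]
    rw [h2] at h1
    simp only [map_smul, map_sum, smul_eq_mul] at h1
    rw [← h1, hN]
    simp [f]
  set d := finrank ℝ ρ.invariants with hd
  have hf1 : f 1 = finrank ℝ W := by simp [f]
  have hvar : ∑ g, (f g - d) ^ 2 = N * (d - d ^ 2) := by
    have : ∀ g, (f g - d) ^ 2 = f g ^ 2 - 2 * d * f g + d ^ 2 := fun g => by ring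
    simp only [this, Finset.sum_add_distrib, Finset.sum_sub_distrib, ← Finset.mul_sum, ← hsq, hbij,
      htr, Finset.sum_const, Finset.card_univ, nsmul_eq_mul, ← hN]
    ring
  have hle : (f 1 - d) ^ 2 ≤ N * (d - d ^ 2) := by
    rw [← hvar]
    exact Finset.single_le_sum (f := fun g => (f g - d) ^ 2) (fun g _ => sq_nonneg _)
      (Finset.mem_univ 1)
  have hd1 : d ≤ 1 := by
    by_contra h
    have h2 : (2 : ℝ) ≤ d := by exact_mod_cast (by omega : 2 ≤ d)
    have h3 : N * ((d : ℝ) - d ^ 2) < 0 := mul_neg_of_pos_of_neg hNpos (by nlinarith)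
    linarith [sq_nonneg (f 1 - d)]
  have hW' : (2 : ℝ) ≤ finrank ℝ W := by exact_mod_cast hW
  have : (d : ℝ) = 0 ∨ (d : ℝ) = 1 := by
    rcases (by omega : d = 0 ∨ d = 1) with h | h <;> simp [h]
  rw [hf1] at hle
  rcases this with h | h <;> rw [h] at hle <;> nlinarith

theorem even_finrank_of_sq_eq_neg {E : Type*} [AddCommGroup E] [Module ℝ E]
    [FiniteDimensional ℝ E] (J : E →ₗ[ℝ] E) (hJ : ∀ x, J (J x) = -x) : Even (finrank ℝ E) := by
  by_contra h
  have h1 : J * J = (-1 : ℝ) • (LinearMap.id : E →ₗ[ℝ] E) := by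
    ext x
    simp [hJ]
  have h2 := congrArg LinearMap.det h1
  rw [map_mul, LinearMap.det_smul, (Nat.not_even_iff_odd.mp h).neg_one_pow, LinearMap.det_id] at h2
  nlinarith [sq_nonneg (LinearMap.det J)]

theorem exists_negative_eigenvalue_of_skew {A : W →ₗ[ℝ] W} (hA0 : A ≠ 0)
    (hA : ∀ x y, ⟪A x, y⟫_ℝ = -⟪x, A y⟫_ℝ) :
    ∃ μ : ℝ, μ < 0 ∧ ∃ v ≠ 0, A (A v) = μ • v := by
  have hT : (A ∘ₗ A).IsSymmetric := fun x y => by simp [hA]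
  have hn : finrank ℝ W = finrank ℝ W := rfl
  have hdiag : ∀ x, ⟪A (A x), x⟫_ℝ = -‖A x‖ ^ 2 := fun x => by
    rw [hA, real_inner_self_eq_norm_sq]
  by_contra! hno
  apply hA0
  have hTz : A ∘ₗ A = 0 := by
    refine (hT.eigenvectorBasis hn).toBasis.ext fun i => ?_
    have h1 : A (A (hT.eigenvectorBasis hn i)) = _ := hT.apply_eigenvectorBasis hn i
    have h2 := hdiag (hT.eigenvectorBasis hn i)
    have hnorm : ‖hT.eigenvectorBasis hn i‖ = 1 := (hT.eigenvectorBasis hn).orthonormal.1 i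
    have h3 : hT.eigenvalues hn i = 0 := by
      by_contra h
      refine hno (hT.eigenvalues hn i) ?_ _ (fun h0 => by simp [h0] at hnorm) h1
      rw [h1] at h2
      simp only [real_inner_smul_left, real_inner_self_eq_norm_sq, hnorm, RCLike.ofReal_real_eq_id,
        id] at h2
      exact lt_of_le_of_ne (by nlinarith [sq_nonneg ‖A (hT.eigenvectorBasis hn i)‖]) h
    simp [h3]
  ext x
  have h1 := hdiag x
  have h2 : A (A x) = 0 := LinearMap.congr_fun hTz x
  rw [h2, inner_zero_left] at h1
  simpa using h1.symm

theorem exists_invariant_complexStructure [Fintype G] (hodd : Odd (Nat.card G)) (n : ℕ) :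
    ∀ (W : Type) [NormedAddCommGroup W] [InnerProductSpace ℝ W] [FiniteDimensional ℝ W]
      (ρ : Representation ℝ G W), (∀ g x y, ⟪ρ g x, ρ g y⟫_ℝ = ⟪x, y⟫_ℝ) →
      finrank ℝ W = n → Even n →
      ∃ J : W →ₗ[ℝ] W, (∀ x, J (J x) = -x) ∧ (∀ x y, ⟪J x, J y⟫_ℝ = ⟪x, y⟫_ℝ) ∧
        ∀ g x, J (ρ g x) = ρ g (J x) := by
  induction n using Nat.strong_induction_on with
  | _ n ih =>
  intro W _ _ _ ρ hρ hW hn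
  by_cases hn0 : n = 0
  · have : Subsingleton W := finrank_zero_iff.mp (hW.trans hn0)
    exact ⟨0, fun x => Subsingleton.elim _ _, fun x y => by simp [Subsingleton.elim x 0],
      fun g x => Subsingleton.elim _ _⟩
  obtain ⟨A, hA0, hskew, hcomm⟩ := exists_skew_commuting hodd ρ hρ
    (by rw [hW]; obtain ⟨k, rfl⟩ := hn; omega)
  obtain ⟨μ, hμ, v, hv0, hv⟩ := exists_negative_eigenvalue_of_skew hA0 hskew
  set p : Submodule ℝ W := Module.End.eigenspace (A ∘ₗ A) μ with hp
  have hmem : ∀ x, x ∈ p ↔ A (A x) = μ • x := fun x => by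
    rw [hp, Module.End.mem_eigenspace_iff]; rfl
  set c : ℝ := √(-μ)
  have hc : c * c = -μ := Real.mul_self_sqrt (by linarith)
  have hc0 : c ≠ 0 := fun h => by rw [h] at hc; linarith
  have hpA : ∀ x ∈ p, c⁻¹ • A x ∈ p := fun x hx => by
    rw [hmem] at hx ⊢
    simp only [map_smul, hx]
    rw [smul_comm]
  have hpA2 : ∀ x ∈ p, c⁻¹ • A (c⁻¹ • A x) = -x := fun x hx => by
    rw [map_smul, (hmem x).mp hx, smul_smul, smul_smul, ← neg_one_smul ℝ x]
    congr 1
    field_simp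
    linarith
  have hpAin : ∀ x ∈ p, ∀ y ∈ p, ⟪c⁻¹ • A x, c⁻¹ • A y⟫_ℝ = ⟪x, y⟫_ℝ := fun x _ y hy => by
    have h := congrArg (fun z => ⟪x, z⟫_ℝ) (hpA2 y hy)
    simp only [map_smul, real_inner_smul_right, inner_neg_right] at h
    rw [real_inner_smul_left, hskew, map_smul, real_inner_smul_right]
    linarith
  have hpρ : ∀ g, ∀ x ∈ p, ρ g x ∈ p := fun g x hx => by
    rw [hmem] at hx ⊢
    rw [hcomm, hcomm, hx, map_smul]
  have hinv : ∀ g x, ρ g (ρ g⁻¹ x) = x := fun g x => by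
    rw [← Module.End.mul_apply, ← map_mul]; simp
  have hqρ : ∀ g, ∀ x ∈ pᗮ, ρ g x ∈ pᗮ := fun g x hx => by
    rw [Submodule.mem_orthogonal] at hx ⊢
    intro u hu
    rw [← hinv g u, hρ]
    exact hx _ (hpρ _ _ hu)
  let τ : Representation ℝ G pᗮ := ρ.subrepresentation pᗮ fun g x hx => hqρ g x hx
  have hτ : ∀ g x, (τ g x : W) = ρ g x := fun g x => rfl
  have heven : Even (finrank ℝ p) := even_finrank_of_sq_eq_neg
    ((c⁻¹ • A).restrict (p := p) (q := p) hpA) fun x => Subtype.ext (hpA2 x x.2)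
  have hppos : 0 < finrank ℝ p := by
    have : Nontrivial p := ⟨⟨⟨v, (hmem v).mpr hv⟩, 0, fun h => hv0 (congrArg Subtype.val h)⟩⟩
    exact finrank_pos
  have hsum := Submodule.finrank_add_finrank_orthogonal p
  obtain ⟨Jq, hJq1, hJq2, hJq3⟩ := ih (finrank ℝ pᗮ) (by omega) pᗮ τ
    (fun g x y => by simpa [hτ] using hρ g x y) rfl
    (by rw [hW] at hsum; rw [← hsum] at hn; exact (Nat.even_add.mp hn).mp heven)
  let J : W →ₗ[ℝ] W := (c⁻¹ • A) ∘ₗ (p.starProjection : W →ₗ[ℝ] W) +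
    pᗮ.subtype ∘ₗ Jq ∘ₗ (pᗮ.orthogonalProjectionOnto : W →ₗ[ℝ] pᗮ)
  have hJ : ∀ a ∈ p, ∀ b : pᗮ, J (a + b) = c⁻¹ • A a + Jq b := by
    intro a ha b
    have h1 : p.starProjection (a + b) = a := by
      rw [map_add, Submodule.starProjection_eq_self_iff.mpr ha, Submodule.starProjection_apply,
        Submodule.orthogonalProjectionOnto_apply_of_mem_orthogonal b.2]
      simp
    have h2 : pᗮ.orthogonalProjectionOnto (a + b) = b := by
      rw [map_add, Submodule.orthogonalProjectionOnto_mem_subspace_eq_self,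
        Submodule.orthogonalProjectionOnto_apply_of_mem_orthogonal
          (Submodule.le_orthogonal_orthogonal p ha), zero_add]
    simp [J, h1, h2]
  have hdec : ∀ x, ∃ a ∈ p, ∃ b : pᗮ, x = a + b := fun x =>
    ⟨p.starProjection x, p.starProjection_apply_mem x,
      ⟨_, p.sub_starProjection_mem_orthogonal x⟩, by simp⟩
  have horth : ∀ a ∈ p, ∀ b : pᗮ, ⟪a, (b : W)⟫_ℝ = 0 := fun a ha b =>
    Submodule.inner_right_of_mem_orthogonal ha b.2
  have horth' : ∀ a ∈ p, ∀ b : pᗮ, ⟪(b : W), a⟫_ℝ = 0 := fun a ha b =>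
    Submodule.inner_left_of_mem_orthogonal ha b.2
  refine ⟨J, fun x => ?_, fun x y => ?_, fun g x => ?_⟩
  · obtain ⟨a, ha, b, rfl⟩ := hdec x
    rw [hJ a ha, hJ _ (hpA a ha), hpA2 a ha, hJq1]
    simp [add_comm]
  · obtain ⟨a, ha, b, rfl⟩ := hdec x
    obtain ⟨a', ha', b', rfl⟩ := hdec y
    have h4 : ⟪(Jq b : W), (Jq b' : W)⟫_ℝ = ⟪(b : W), (b' : W)⟫_ℝ := hJq2 b b'
    rw [hJ a ha, hJ a' ha', inner_add_left, inner_add_right, inner_add_right, hpAin a ha a' ha', h4,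
      horth _ (hpA a ha), horth' _ (hpA a' ha'), inner_add_left, inner_add_right, inner_add_right,
      horth a ha, horth' a' ha']
  · obtain ⟨a, ha, b, rfl⟩ := hdec x
    rw [map_add, ← hτ, hJ _ (hpρ g a ha), hJ a ha, hcomm, hJq3, map_add, hτ, map_smul]

end InvariantComplexStructure

theorem exists_diffeomorph_prod_sphere_of_cocycle {G E : Type*} [Group G] [NormedAddCommGroup E]
    [InnerProductSpace ℝ E] [FiniteDimensional ℝ E] {n : ℕ} [Fact (finrank ℝ E = n + 1)]
    (α : Representation ℝ G E) (hα : ∀ g x, ‖α g x‖ = ‖x‖) (c : G → E → E →L[ℝ] E)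
    (hc : ∀ g x y, ‖x‖ = 1 → ‖c g x y‖ = ‖y‖) (hc_one : ∀ x y, ‖x‖ = 1 → c 1 x y = y)
    (hc_mul : ∀ g h x y, ‖x‖ = 1 → c (g * h) x y = c g (α h x) (c h x y))
    (hsmooth : ∀ g x, ‖x‖ = 1 → ContDiffAt ℝ (⊤ : ℕ∞) (c g) x)
    (hfree : ∀ g x y, ‖x‖ = 1 → ‖y‖ = 1 → α g x = x → c g x y = y → g = 1) :
    ∃ ρ : G → Diffeomorph ((𝓡 n).prod (𝓡 n)) ((𝓡 n).prod (𝓡 n))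
        (Metric.sphere (0 : E) 1 × Metric.sphere (0 : E) 1)
        (Metric.sphere (0 : E) 1 × Metric.sphere (0 : E) 1) (⊤ : ℕ∞),
      (∀ g h : G, ∀ x, ρ (g * h) x = ρ g (ρ h x)) ∧ (∀ g : G, g ≠ 1 → ∀ x, ρ g x ≠ x) := by
  have hnorm : ∀ x : Metric.sphere (0 : E) 1, ‖(x : E)‖ = 1 := fun x => by simp
  let Φ : G → (Metric.sphere (0 : E) 1 × Metric.sphere (0 : E) 1) →
      (Metric.sphere (0 : E) 1 × Metric.sphere (0 : E) 1) := fun g p =>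
    (⟨α g p.1, by simp [hα]⟩, ⟨c g p.1 p.2, by simp [hc g p.1 p.2 (hnorm p.1)]⟩)
  have hΦ_mul : ∀ g h p, Φ (g * h) p = Φ g (Φ h p) := by
    intro g h p
    refine Prod.ext (Subtype.ext ?_) (Subtype.ext ?_)
    · simp [Φ]
    · simp [Φ, hc_mul g h p.1 p.2 (hnorm p.1)]
  have hΦ_one : ∀ p, Φ 1 p = p := by
    intro p
    refine Prod.ext (Subtype.ext ?_) (Subtype.ext ?_)
    · simp [Φ]
    · simp [Φ, hc_one p.1 p.2 (hnorm p.1)]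
  have hΦ_smooth : ∀ g, ContMDiff ((𝓡 n).prod (𝓡 n)) ((𝓡 n).prod (𝓡 n)) (⊤ : ℕ∞) (Φ g) := by
    intro g
    have hcoe : ContMDiff (𝓡 n) 𝓘(ℝ, E) (⊤ : ℕ∞) ((↑) : Metric.sphere (0 : E) 1 → E) :=
      contMDiff_coe_sphere
    have h1 := hcoe.comp
      (contMDiff_fst (I := 𝓡 n) (J := 𝓡 n) (M := Metric.sphere (0 : E) 1)
        (N := Metric.sphere (0 : E) 1))
    have h2 := hcoe.comp
      (contMDiff_snd (I := 𝓡 n) (J := 𝓡 n) (M := Metric.sphere (0 : E) 1)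
        (N := Metric.sphere (0 : E) 1))
    refine ContMDiff.prodMk ?_ ?_
    · refine ContMDiff.codRestrict_sphere (f := fun p : Metric.sphere (0 : E) 1 × Metric.sphere (0 : E) 1 =>
        α g p.1) ?_ _
      exact ((α g).toContinuousLinearMap.contDiff (n := (⊤ : ℕ∞))).contMDiff.comp h1
    · refine ContMDiff.codRestrict_sphere (f := fun p : Metric.sphere (0 : E) 1 × Metric.sphere (0 : E) 1 =>
        c g p.1 p.2) ?_ _
      intro p
      have h3 : ContDiffAt ℝ (⊤ : ℕ∞) (fun q : E × E => c g q.1 q.2) (p.1, p.2) :=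
        ((hsmooth g p.1 (hnorm p.1)).comp ((p.1 : E), (p.2 : E)) contDiffAt_fst).clm_apply
          contDiffAt_snd
      exact h3.contMDiffAt.comp p ((h1 p).prodMk_space (h2 p))
  refine ⟨fun g => ⟨⟨Φ g, Φ g⁻¹, fun p => ?_, fun p => ?_⟩, hΦ_smooth g, hΦ_smooth g⁻¹⟩,
    hΦ_mul, fun g hg p hp => hg ?_⟩
  · rw [← hΦ_mul, inv_mul_cancel, hΦ_one]
  · rw [← hΦ_mul, mul_inv_cancel, hΦ_one]
  · have hp' : Φ g p = p := hp
    exact hfree g p.1 p.2 (hnorm _) (hnorm _) (congrArg (fun q => (q.1 : E)) hp')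
      (congrArg (fun q => (q.2 : E)) hp')

section Align

variable {U X : Type*} [NormedAddCommGroup U] [InnerProductSpace ℝ U] [FiniteDimensional ℝ U]
  [NormedAddCommGroup X] [InnerProductSpace ℝ X] [FiniteDimensional ℝ X]

open ContinuousLinearMap (adjoint)

/-- An orthogonal map `R` with `R ∘ S = S₀`, for isometries `S`, `S₀` which agree only at `0`. -/
def alignIsometry (S₀ S : U →L[ℝ] X) : X →L[ℝ] X :=
  1 - (S - S₀) ∘L Ring.inverse ((1 : U →L[ℝ] U) - adjoint S₀ ∘L S) ∘L adjoint (S - S₀)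

variable {S₀ S : U →L[ℝ] X}

theorem isUnit_one_sub_adjoint_comp (hS₀ : ∀ z, ‖S₀ z‖ = ‖z‖) (hS : ∀ z, ‖S z‖ = ‖z‖)
    (hne : ∀ z, S z = S₀ z → z = 0) :
    IsUnit ((1 : U →L[ℝ] U) - adjoint S₀ ∘L S) := by
  rw [ContinuousLinearMap.isUnit_iff_bijective]
  have hinj : Function.Injective ((1 : U →L[ℝ] U) - adjoint S₀ ∘L S) := by
    rw [injective_iff_map_eq_zero]
    intro z hz
    have h1 : adjoint S₀ (S z) = z := by
      have h0 : z - adjoint S₀ (S z) = 0 := hz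
      exact (sub_eq_zero.mp h0).symm
    have h2 : ⟪S₀ z, S z⟫_ℝ = ‖z‖ ^ 2 := by
      rw [← ContinuousLinearMap.adjoint_inner_right, h1, real_inner_self_eq_norm_sq]
    refine hne z (sub_eq_zero.mp (norm_eq_zero.mp (sq_eq_zero_iff.mp ?_)))
    rw [norm_sub_sq_real, real_inner_comm, h2, hS, hS₀]
    ring
  exact ⟨hinj, LinearMap.injective_iff_surjective.mp hinj⟩

theorem contDiffAt_alignIsometry {n : WithTop ℕ∞} (hS₀ : ∀ z, ‖S₀ z‖ = ‖z‖) (hS : ∀ z, ‖S z‖ = ‖z‖)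
    (hne : ∀ z, S z = S₀ z → z = 0) :
    ContDiffAt ℝ n (alignIsometry S₀) S := by
  let adj : (U →L[ℝ] X) →L[ℝ] (X →L[ℝ] U) := LinearMap.toContinuousLinearMap
    { toFun := fun A => adjoint A
      map_add' := fun A B => map_add _ A B
      map_smul' := fun r A => by simp }
  have h1 : ContDiffAt ℝ n (fun A : U →L[ℝ] X => (1 : U →L[ℝ] U) - adjoint S₀ ∘L A) S := by
    fun_prop
  have h2 : ContDiffAt ℝ n (fun A : U →L[ℝ] X => 
      Ring.inverse ((1 : U →L[ℝ] U) - adjoint S₀ ∘L A)) S := by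
    obtain ⟨w, hw⟩ := isUnit_one_sub_adjoint_comp hS₀ hS hne
    have h3 := contDiffAt_ringInverse (n := n) ℝ w
    rw [hw] at h3
    exact h3.comp S h1
  have h3 : ContDiffAt ℝ n (fun A : U →L[ℝ] X => adjoint (A - S₀)) S :=
    adj.contDiff.contDiffAt.comp S (by fun_prop)
  have h4 : ContDiffAt ℝ n (fun A : U →L[ℝ] X => A - S₀) S := by fun_prop
  exact contDiffAt_const.sub (h4.clm_comp (h2.clm_comp h3))

theorem alignIsometry_apply_self (hS₀ : ∀ z, ‖S₀ z‖ = ‖z‖) (hS : ∀ z, ‖S z‖ = ‖z‖)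
    (hne : ∀ z, S z = S₀ z → z = 0) (z : U) :
    alignIsometry S₀ S (S z) = S₀ z := by
  have hSS : adjoint S (S z) = z := by
    have := (ContinuousLinearMap.norm_map_iff_adjoint_comp_self S).mp hS
    exact DFunLike.congr_fun this z
  have h1 : adjoint (S - S₀) (S z) = ((1 : U →L[ℝ] U) - adjoint S₀ ∘L S) z := by simp [hSS]
  have h2 := DFunLike.congr_fun
    (Ring.inverse_mul_cancel _ (isUnit_one_sub_adjoint_comp hS₀ hS hne)) z
  have h3 : Ring.inverse ((1 : U →L[ℝ] U) - adjoint S₀ ∘L S) (((1 : U →L[ℝ] U) - adjoint S₀ ∘L S) z) = z := h2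
  simp only [alignIsometry, sub_apply, one_apply_eq_self,
    ContinuousLinearMap.comp_apply] at h1 h3 ⊢
  rw [h1, h3]
  abel

theorem norm_alignIsometry_apply (hS₀ : ∀ z, ‖S₀ z‖ = ‖z‖) (hS : ∀ z, ‖S z‖ = ‖z‖)
    (hne : ∀ z, S z = S₀ z → z = 0) (x : X) :
    ‖alignIsometry S₀ S x‖ = ‖x‖ := by
  obtain ⟨z, hz⟩ : ∃ z, z = Ring.inverse ((1 : U →L[ℝ] U) - adjoint S₀ ∘L S) (adjoint (S - S₀) x) := ⟨_, rfl⟩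
  have h1 : z - adjoint S₀ (S z) = adjoint (S - S₀) x := by
    have h2 := DFunLike.congr_fun
      (Ring.mul_inverse_cancel _ (isUnit_one_sub_adjoint_comp hS₀ hS hne)) (adjoint (S - S₀) x)
    simpa [hz] using h2
  have h2 : alignIsometry S₀ S x = x - (S - S₀) z := by rw [hz]; rfl
  have h3 : ⟪x, (S - S₀) z⟫_ℝ = ‖z‖ ^ 2 - ⟪S z, S₀ z⟫_ℝ := by
    rw [← ContinuousLinearMap.adjoint_inner_left, ← h1, inner_sub_left,
      ContinuousLinearMap.adjoint_inner_left, real_inner_self_eq_norm_sq]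
  have h4 : ‖(S - S₀) z‖ ^ 2 = 2 * (‖z‖ ^ 2 - ⟪S z, S₀ z⟫_ℝ) := by
    rw [sub_apply, norm_sub_sq_real, hS, hS₀]
    ring
  rw [h2, ← sq_eq_sq₀ (norm_nonneg _) (norm_nonneg _), norm_sub_sq_real, h3, h4]
  ring

end Align

theorem contDiff_toContinuousLinearMap_apply {U X W : Type*} [NormedAddCommGroup U]
    [InnerProductSpace ℝ U] [FiniteDimensional ℝ U] [NormedAddCommGroup X] [InnerProductSpace ℝ X]
    [NormedAddCommGroup W] [InnerProductSpace ℝ W] [FiniteDimensional ℝ W]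
    (m : W →ₗ[ℝ] U →ₗ[ℝ] X) {n : WithTop ℕ∞} :
    ContDiff ℝ n (fun w => LinearMap.toContinuousLinearMap (m w)) :=
  (LinearMap.toContinuousLinearMap
    { toFun := fun w => LinearMap.toContinuousLinearMap (m w)
      map_add' := fun w w' => by simp
      map_smul' := fun r w => by simp }).contDiff

section Twist

variable {U X : Type*} [NormedAddCommGroup U] [InnerProductSpace ℝ U] [FiniteDimensional ℝ U]
  [NormedAddCommGroup X] [InnerProductSpace ℝ X] [FiniteDimensional ℝ X]

open ContinuousLinearMap (adjoint)

theorem adjoint_apply_apply_of_norm_map {S : U →L[ℝ] X} (hS : ∀ z, ‖S z‖ = ‖z‖) (z : U) :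
    adjoint S (S z) = z :=
  DFunLike.congr_fun ((ContinuousLinearMap.norm_map_iff_adjoint_comp_self S).mp hS) z

theorem apply_adjoint_apply_of_norm_map {R : X →L[ℝ] X} (hR : ∀ z, ‖R z‖ = ‖z‖) (z : X) :
    R (adjoint R z) = z := by
  have hinj : Function.Injective R :=
    Function.LeftInverse.injective (adjoint_apply_apply_of_norm_map hR)
  obtain ⟨w, rfl⟩ := (LinearMap.injective_iff_surjective (f := (R : X →ₗ[ℝ] X))).mp hinj z
  exact congrArg R (adjoint_apply_apply_of_norm_map hR w)

theorem contDiff_adjoint {n : WithTop ℕ∞} :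
    ContDiff ℝ n (fun A : U →L[ℝ] X => adjoint A) :=
  (LinearMap.toContinuousLinearMap
    { toFun := fun A : U →L[ℝ] X => adjoint A
      map_add' := fun A B => map_add _ A B
      map_smul' := fun r A => by simp }).contDiff

/-- An isometric parametrization of the orthogonal complement of the range of `S`. -/
theorem exists_norm_map_range_eq_orthogonal {E : Type*} [NormedAddCommGroup E]
    [InnerProductSpace ℝ E] [FiniteDimensional ℝ E] {S : U →L[ℝ] X} (hS : ∀ z, ‖S z‖ = ‖z‖)
    (hdim : finrank ℝ E + finrank ℝ U = finrank ℝ X) :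
    ∃ I : E →L[ℝ] X, (∀ y, ‖I y‖ = ‖y‖) ∧ (∀ y z, ⟪I y, S z⟫_ℝ = 0) ∧
      ∀ v, (∀ z, ⟪v, S z⟫_ℝ = 0) → I (adjoint I v) = v := by
  have hinj : Function.Injective S :=
    Function.LeftInverse.injective (adjoint_apply_apply_of_norm_map hS)
  let F : Submodule ℝ X := (LinearMap.range (S : U →ₗ[ℝ] X))ᗮ
  have h1 : finrank ℝ (LinearMap.range (S : U →ₗ[ℝ] X)) = finrank ℝ U :=
    LinearMap.finrank_range_of_inj hinj
  have h2 := (LinearMap.range (S : U →ₗ[ℝ] X)).finrank_add_finrank_orthogonal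
  have hF : finrank ℝ E = finrank ℝ F := by
    change _ = finrank ℝ ((LinearMap.range (S : U →ₗ[ℝ] X))ᗮ : Submodule ℝ X)
    omega
  let e : E ≃ₗᵢ[ℝ] F := ((stdOrthonormalBasis ℝ E).reindex (finCongr hF)).repr.trans
    (stdOrthonormalBasis ℝ F).repr.symm
  let I : E →ₗᵢ[ℝ] X := F.subtypeₗᵢ.comp e.toLinearIsometry
  have hI : ∀ y, ‖I.toContinuousLinearMap y‖ = ‖y‖ := fun y => I.norm_map y
  refine ⟨I.toContinuousLinearMap, hI, fun y z => ?_, fun v hv => ?_⟩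
  · rw [real_inner_comm]
    exact (Submodule.mem_orthogonal _ _).mp (e y).2 (S z) ⟨z, rfl⟩
  · have hvF : v ∈ F := by
      rw [Submodule.mem_orthogonal]
      rintro _ ⟨z, rfl⟩
      rw [real_inner_comm]
      exact hv z
    have hv' : v = I.toContinuousLinearMap (e.symm ⟨v, hvF⟩) := by simp [I]
    rw [hv', adjoint_apply_apply_of_norm_map hI]

theorem exists_free_smooth_action_of_frame {G E : Type*} [Group G] [NormedAddCommGroup E]
    [InnerProductSpace ℝ E] [FiniteDimensional ℝ E] {n : ℕ} [Fact (finrank ℝ E = n + 1)]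
    (hdim : finrank ℝ E + finrank ℝ U = finrank ℝ X)
    (α : Representation ℝ G E) (hα : ∀ g x, ‖α g x‖ = ‖x‖)
    (σ : Representation ℝ G X) (hσ : ∀ g v w, ⟪σ g v, σ g w⟫_ℝ = ⟪v, w⟫_ℝ)
    {S₀ : U →L[ℝ] X} (hS₀ : ∀ z, ‖S₀ z‖ = ‖z‖) (S : E → U →L[ℝ] X)
    (hS : ∀ x z, ‖x‖ = 1 → ‖S x z‖ = ‖z‖) (hne : ∀ x z, S x z = S₀ z → z = 0)
    (hsmooth : ∀ x, ‖x‖ = 1 → ContDiffAt ℝ (⊤ : ℕ∞) S x)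
    (hequiv : ∀ g x z, S (α g x) z = σ g (S x z))
    (hfree : ∀ g x v, ‖x‖ = 1 → α g x = x → σ g v = v → (∀ z, ⟪v, S x z⟫_ℝ = 0) → v ≠ 0 →
      g = 1) :
    ∃ ρ : G → Diffeomorph ((𝓡 n).prod (𝓡 n)) ((𝓡 n).prod (𝓡 n))
        (Metric.sphere (0 : E) 1 × Metric.sphere (0 : E) 1)
        (Metric.sphere (0 : E) 1 × Metric.sphere (0 : E) 1) (⊤ : ℕ∞),
      (∀ g h : G, ∀ x, ρ (g * h) x = ρ g (ρ h x)) ∧ (∀ g : G, g ≠ 1 → ∀ x, ρ g x ≠ x) := by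
  obtain ⟨I, hI, hIS, hIv⟩ := exists_norm_map_range_eq_orthogonal (E := E) hS₀ hdim
  let R : E → X →L[ℝ] X := fun x => alignIsometry S₀ (S x)
  have hR : ∀ x, ‖x‖ = 1 → ∀ v, ‖R x v‖ = ‖v‖ := fun x hx =>
    norm_alignIsometry_apply hS₀ (hS x · hx) (hne x)
  have hRS : ∀ x z, ‖x‖ = 1 → R x (S x z) = S₀ z := fun x z hx =>
    alignIsometry_apply_self hS₀ (hS x · hx) (hne x) z
  have hRi : ∀ x, ‖x‖ = 1 → ∀ v w, ⟪R x v, R x w⟫_ℝ = ⟪v, w⟫_ℝ := fun x hx v w =>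
    (⟨(R x : X →ₗ[ℝ] X), hR x hx⟩ : X →ₗᵢ[ℝ] X).inner_map_map v w
  let V : E → E → X := fun x y => adjoint (R x) (I y)
  have hRV : ∀ x y, ‖x‖ = 1 → R x (V x y) = I y := fun x y hx =>
    apply_adjoint_apply_of_norm_map (hR x hx) _
  have hVS : ∀ x y z, ‖x‖ = 1 → ⟪V x y, S x z⟫_ℝ = 0 := fun x y z hx => by
    rw [← hRi x hx, hRV x y hx, hRS x z hx, hIS]
  have hαx : ∀ g x, ‖x‖ = 1 → ‖α g x‖ = 1 := fun g x hx => (hα g x).trans hx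
  have hσn : ∀ g v, ‖σ g v‖ = ‖v‖ := fun g v => by
    rw [@norm_eq_sqrt_real_inner X, @norm_eq_sqrt_real_inner X, hσ]
  let c : G → E → E →L[ℝ] E := fun g x =>
    adjoint I ∘L R (α g x) ∘L LinearMap.toContinuousLinearMap (σ g) ∘L adjoint (R x) ∘L I
  have hc : ∀ g x y, ‖x‖ = 1 → I (c g x y) = R (α g x) (σ g (V x y)) := fun g x y hx => by
    refine hIv _ fun z => ?_
    rw [← hRS (α g x) z (hαx g x hx)]
    change ⟪R (α g x) (σ g (V x y)), _⟫_ℝ = 0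
    rw [hRi _ (hαx g x hx), hequiv, hσ, hVS x y z hx]
  have hV : ∀ g x y, ‖x‖ = 1 → V (α g x) (c g x y) = σ g (V x y) := fun g x y hx => by
    change adjoint (R (α g x)) (I (c g x y)) = _
    rw [hc g x y hx, adjoint_apply_apply_of_norm_map (hR _ (hαx g x hx))]
  have hVn : ∀ x y, ‖x‖ = 1 → ‖V x y‖ = ‖y‖ := fun x y hx => by
    rw [← hR x hx, hRV x y hx, hI]
  have hIinj : Function.Injective I :=
    Function.LeftInverse.injective (adjoint_apply_apply_of_norm_map hI)
  have hRsmooth : ∀ x, ‖x‖ = 1 → ContDiffAt ℝ (⊤ : ℕ∞) R x := fun x hx =>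
    (contDiffAt_alignIsometry hS₀ (hS x · hx) (hne x)).comp x (hsmooth x hx)
  refine exists_diffeomorph_prod_sphere_of_cocycle α hα c (fun g x y hx => ?_)
    (fun x y hx => hIinj ?_) (fun g h x y hx => hIinj ?_) (fun g x hx => ?_)
    fun g x y hx hy hgx hgy => ?_
  · rw [← hI, hc g x y hx, hR _ (hαx g x hx), hσn, hVn x y hx]
  · rw [hc 1 x y hx]
    simp [hRV x y hx]
  · rw [hc _ _ _ hx, hc _ _ _ (hαx h x hx), hV h x y hx]
    simp
  · have h1 : ContDiffAt ℝ (⊤ : ℕ∞) (fun y => R (α g y)) x :=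
      (hRsmooth (α g x) (hαx g x hx)).comp x
        (LinearMap.toContinuousLinearMap (α g)).contDiff.contDiffAt
    have h2 : ContDiffAt ℝ (⊤ : ℕ∞) (fun y => adjoint (R y)) x :=
      contDiff_adjoint.contDiffAt.comp x (hRsmooth x hx)
    exact contDiffAt_const.clm_comp (h1.clm_comp (contDiffAt_const.clm_comp
      (h2.clm_comp contDiffAt_const)))
  · have h1 := hV g x y hx
    rw [hgx, hgy] at h1
    refine hfree g x (V x y) hx hgx h1.symm (fun z => hVS x y z hx) fun h0 => ?_
    have h2 := hVn x y hx
    simp [h0, hy] at h2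

end Twist

section ComplexFrame

variable {W : Type*} [NormedAddCommGroup W] [InnerProductSpace ℝ W]

theorem inner_map_self_eq_zero_of_sq_eq_neg {J : W →ₗ[ℝ] W} (hJ : ∀ x, J (J x) = -x)
    (hJi : ∀ x y, ⟪J x, J y⟫_ℝ = ⟪x, y⟫_ℝ) (x : W) : ⟪x, J x⟫_ℝ = 0 := by
  have h := hJi x (J x)
  rw [hJ, inner_neg_right, real_inner_comm] at h
  linarith

theorem norm_smul_add_smul_map_sq {J : W →ₗ[ℝ] W} (hJ : ∀ x, J (J x) = -x)
    (hJi : ∀ x y, ⟪J x, J y⟫_ℝ = ⟪x, y⟫_ℝ) (a b : ℝ) (x : W) :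
    ‖a • x + b • J x‖ ^ 2 = (a ^ 2 + b ^ 2) * ‖x‖ ^ 2 := by
  have h : ‖J x‖ ^ 2 = ‖x‖ ^ 2 := by
    rw [← real_inner_self_eq_norm_sq, hJi, real_inner_self_eq_norm_sq]
  rw [norm_add_sq_real, inner_smul_left, inner_smul_right,
    inner_map_self_eq_zero_of_sq_eq_neg hJ hJi, norm_smul, norm_smul, mul_pow, mul_pow, h]
  simp
  ring

/-- The map `(w, z) ↦ ((z₀ + z₁ J) w, (z₂ + z₃ J) w)`. -/
def complexFrame (J : W →ₗ[ℝ] W) :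
    W →ₗ[ℝ] EuclideanSpace ℝ (Fin 4) →ₗ[ℝ] WithLp 2 (W × W) :=
  LinearMap.mk₂ ℝ (fun w z => WithLp.toLp 2 (z 0 • w + z 1 • J w, z 2 • w + z 3 • J w))
    (fun w w' z => by
      rw [← WithLp.toLp_add]
      simp only [map_add, Prod.mk_add_mk]
      congr 2 <;> module)
    (fun r w z => by
      rw [← WithLp.toLp_smul]
      simp only [map_smul, Prod.smul_mk]
      congr 2 <;> module)
    (fun w z z' => by
      simp only [PiLp.add_apply, ← WithLp.toLp_add, Prod.mk_add_mk]
      congr 2 <;> module)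
    (fun r w z => by
      simp only [PiLp.smul_apply, ← WithLp.toLp_smul, Prod.smul_mk, smul_eq_mul]
      congr 2 <;> module)

/-- The map `z ↦ ((z₂ + z₃ J) e, (z₀ + z₁ J) f)`. -/
def crossFrame (J : W →ₗ[ℝ] W) (e f : W) :
    EuclideanSpace ℝ (Fin 4) →ₗ[ℝ] WithLp 2 (W × W) where
  toFun z := WithLp.toLp 2 (z 2 • e + z 3 • J e, z 0 • f + z 1 • J f)
  map_add' z z' := by
    simp only [PiLp.add_apply, ← WithLp.toLp_add, Prod.mk_add_mk]
    congr 2 <;> module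
  map_smul' r z := by
    simp only [PiLp.smul_apply, RingHom.id_apply, ← WithLp.toLp_smul, Prod.smul_mk, smul_eq_mul]
    congr 2 <;> module

theorem norm_complexFrame {J : W →ₗ[ℝ] W} (hJ : ∀ x, J (J x) = -x)
    (hJi : ∀ x y, ⟪J x, J y⟫_ℝ = ⟪x, y⟫_ℝ) {w : W} (hw : ‖w‖ = 1) (z) :
    ‖complexFrame J w z‖ = ‖z‖ := by
  rw [← sq_eq_sq₀ (norm_nonneg _) (norm_nonneg _), WithLp.prod_norm_sq_eq_of_L2,
    EuclideanSpace.real_norm_sq_eq]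
  simp only [complexFrame, LinearMap.mk₂_apply, WithLp.toLp_fst, WithLp.toLp_snd, norm_smul_add_smul_map_sq hJ hJi, hw,
    Fin.sum_univ_four]
  ring

theorem norm_crossFrame {J : W →ₗ[ℝ] W} (hJ : ∀ x, J (J x) = -x)
    (hJi : ∀ x y, ⟪J x, J y⟫_ℝ = ⟪x, y⟫_ℝ) {e f : W} (he : ‖e‖ = 1) (hf : ‖f‖ = 1) (z) :
    ‖crossFrame J e f z‖ = ‖z‖ := by
  rw [← sq_eq_sq₀ (norm_nonneg _) (norm_nonneg _), WithLp.prod_norm_sq_eq_of_L2,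
    EuclideanSpace.real_norm_sq_eq]
  simp only [crossFrame, LinearMap.coe_mk, AddHom.coe_mk, WithLp.toLp_fst, WithLp.toLp_snd, norm_smul_add_smul_map_sq hJ hJi, he, hf,
    Fin.sum_univ_four]
  ring

theorem mem_span_pair_of_smul_add_smul_map_mem {J : W →ₗ[ℝ] W} (hJ : ∀ x, J (J x) = -x)
    {e w : W} {a b : ℝ} (hab : a ^ 2 + b ^ 2 ≠ 0)
    (h : a • w + b • J w ∈ Submodule.span ℝ {e, J e}) :
    w ∈ Submodule.span ℝ {e, J e} := by
  obtain ⟨c, d, hcd⟩ := Submodule.mem_span_pair.mp h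
  have h1 := congrArg J hcd
  simp only [map_add, map_smul, hJ] at h1
  have h2 : (a ^ 2 + b ^ 2) • w = (a * c + b * d) • e + (a * d - b * c) • J e := by
    have h3 : (a ^ 2 + b ^ 2) • w = a • (a • w + b • J w) - b • (a • J w + b • -w) := by module
    rw [h3, ← h1, ← hcd]
    module
  refine Submodule.mem_span_pair.mpr
    ⟨(a ^ 2 + b ^ 2)⁻¹ * (a * c + b * d), (a ^ 2 + b ^ 2)⁻¹ * (a * d - b * c), ?_⟩
  rw [mul_smul, mul_smul, ← smul_add, ← h2, smul_smul, inv_mul_cancel₀ hab, one_smul]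

theorem eq_zero_of_complexFrame_eq_crossFrame {J : W →ₗ[ℝ] W} (hJ : ∀ x, J (J x) = -x)
    (hJi : ∀ x y, ⟪J x, J y⟫_ℝ = ⟪x, y⟫_ℝ) {e f : W} (he : ‖e‖ = 1)
    (hf : f ∉ Submodule.span ℝ {e, J e}) {w : W} {z : EuclideanSpace ℝ (Fin 4)}
    (h : complexFrame J w z = crossFrame J e f z) : z = 0 := by
  have h1 : z 0 • w + z 1 • J w = z 2 • e + z 3 • J e := congrArg WithLp.fst h
  have h2 : z 2 • w + z 3 • J w = z 0 • f + z 1 • J f := congrArg WithLp.snd h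
  have hP : ∀ v ∈ Submodule.span ℝ {e, J e}, J v ∈ Submodule.span ℝ {e, J e} := by
    intro v hv
    obtain ⟨c, d, rfl⟩ := Submodule.mem_span_pair.mp hv
    refine Submodule.mem_span_pair.mpr ⟨-d, c, ?_⟩
    simp only [map_add, map_smul, hJ]
    module
  have h01 : z 0 ^ 2 + z 1 ^ 2 = 0 := by
    by_contra h0
    have hw : w ∈ Submodule.span ℝ {e, J e} := by
      refine mem_span_pair_of_smul_add_smul_map_mem hJ h0 ?_
      rw [h1]
      exact Submodule.mem_span_pair.mpr ⟨_, _, rfl⟩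
    refine hf (mem_span_pair_of_smul_add_smul_map_mem hJ h0 ?_)
    rw [← h2]
    exact Submodule.add_mem _ (Submodule.smul_mem _ _ hw) (Submodule.smul_mem _ _ (hP w hw))
  have hz0 : z 0 = 0 := by nlinarith [sq_nonneg (z 0), sq_nonneg (z 1)]
  have hz1 : z 1 = 0 := by nlinarith [sq_nonneg (z 0), sq_nonneg (z 1)]
  have h23 : z 2 ^ 2 + z 3 ^ 2 = 0 := by
    have h3 := norm_smul_add_smul_map_sq hJ hJi (z 2) (z 3) e
    rw [← h1, hz0, hz1, he] at h3
    simpa using h3.symm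
  have hz2 : z 2 = 0 := by nlinarith [sq_nonneg (z 2), sq_nonneg (z 3)]
  have hz3 : z 3 = 0 := by nlinarith [sq_nonneg (z 2), sq_nonneg (z 3)]
  ext i
  fin_cases i <;> assumption

/-- The diagonal action of a representation on the orthogonal sum of two copies. -/
def diagonalRepresentation {G : Type*} [Group G] (ρ : Representation ℝ G W) :
    Representation ℝ G (WithLp 2 (W × W)) where
  toFun g :=
    { toFun := fun v => WithLp.toLp 2 (ρ g v.fst, ρ g v.snd)
      map_add' := fun v w => by simp [← WithLp.toLp_add]
      map_smul' := fun r v => by simp [← WithLp.toLp_smul] }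
  map_one' := LinearMap.ext fun v => by
    simp only [map_one]
    rfl
  map_mul' g h := LinearMap.ext fun v => by
    simp only [map_mul]
    rfl

theorem diagonalRepresentation_apply {G : Type*} [Group G] (ρ : Representation ℝ G W) (g v) :
    diagonalRepresentation ρ g v = WithLp.toLp 2 (ρ g v.fst, ρ g v.snd) :=
  rfl

theorem exists_free_smooth_action_of_equivariant_map {G E : Type*} [Group G]
    [NormedAddCommGroup E] [InnerProductSpace ℝ E] [FiniteDimensional ℝ E] {n : ℕ}
    [Fact (finrank ℝ E = n + 1)] [FiniteDimensional ℝ W]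
    (hdim : finrank ℝ E + 4 = 2 * finrank ℝ W)
    (α : Representation ℝ G E) (hα : ∀ g x, ‖α g x‖ = ‖x‖)
    (ρ : Representation ℝ G W) (hρ : ∀ g v w, ⟪ρ g v, ρ g w⟫_ℝ = ⟪v, w⟫_ℝ)
    {J : W →ₗ[ℝ] W} (hJ : ∀ x, J (J x) = -x) (hJi : ∀ x y, ⟪J x, J y⟫_ℝ = ⟪x, y⟫_ℝ)
    (hJρ : ∀ g x, J (ρ g x) = ρ g (J x)) (hW : 2 < finrank ℝ W)
    {s : E → W} (hs : ContDiff ℝ (⊤ : ℕ∞) s) (hs0 : ∀ x, x ≠ 0 → s x ≠ 0)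
    (hsα : ∀ g x, s (α g x) = ρ g (s x))
    (hfree : ∀ g x w, x ≠ 0 → α g x = x → ρ g w = w → ⟪w, s x⟫_ℝ = 0 →
      ⟪w, J (s x)⟫_ℝ = 0 → w ≠ 0 → g = 1) :
    ∃ ρ : G → Diffeomorph ((𝓡 n).prod (𝓡 n)) ((𝓡 n).prod (𝓡 n))
        (Metric.sphere (0 : E) 1 × Metric.sphere (0 : E) 1)
        (Metric.sphere (0 : E) 1 × Metric.sphere (0 : E) 1) (⊤ : ℕ∞),
      (∀ g h : G, ∀ x, ρ (g * h) x = ρ g (ρ h x)) ∧ (∀ g : G, g ≠ 1 → ∀ x, ρ g x ≠ x) := by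
  have : Nontrivial W := Module.nontrivial_of_finrank_pos (R := ℝ) (by omega)
  obtain ⟨e, he⟩ := exists_norm_eq W zero_le_one
  obtain ⟨f, hfP, hf⟩ : ∃ f, f ∉ Submodule.span ℝ {e, J e} ∧ ‖f‖ = 1 := by
    have hlt : Submodule.span ℝ {e, J e} < ⊤ := by
      rw [lt_top_iff_ne_top]
      intro htop
      classical
      have h1 := finrank_span_le_card (R := ℝ) ({e, J e} : Set W)
      rw [htop, finrank_top] at h1
      have h2 := Set.ncard_insert_le e {J e}
      rw [Set.ncard_singleton, Set.ncard_eq_toFinset_card'] at h2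
      omega
    obtain ⟨f, -, hf⟩ := SetLike.exists_of_lt hlt
    have hf0 : f ≠ 0 := by
      rintro rfl
      exact hf (Submodule.zero_mem _)
    refine ⟨‖f‖⁻¹ • f, fun h => hf ?_, norm_smul_inv_norm hf0⟩
    have h1 := Submodule.smul_mem _ ‖f‖ h
    rwa [smul_inv_smul₀ (norm_ne_zero_iff.mpr hf0)] at h1
  let u : E → W := fun x => ‖s x‖⁻¹ • s x
  have hx0 : ∀ x : E, ‖x‖ = 1 → x ≠ 0 := by
    rintro x hx rfl
    simp at hx
  have hu : ∀ x, ‖x‖ = 1 → ‖u x‖ = 1 := fun x hx => norm_smul_inv_norm (hs0 x (hx0 x hx))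
  have hρn : ∀ g v, ‖ρ g v‖ = ‖v‖ := fun g v => by
    rw [@norm_eq_sqrt_real_inner W, @norm_eq_sqrt_real_inner W, hρ]
  have huρ : ∀ g x, u (α g x) = ρ g (u x) := fun g x => by simp [u, hsα, hρn]
  refine exists_free_smooth_action_of_frame (U := EuclideanSpace ℝ (Fin 4))
    (X := WithLp 2 (W × W)) ?_ α hα (diagonalRepresentation ρ) (fun g v w => ?_)
    (S₀ := LinearMap.toContinuousLinearMap (crossFrame J e f)) (norm_crossFrame hJ hJi he hf)
    (fun x => LinearMap.toContinuousLinearMap (complexFrame J (u x)))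
    (fun x z hx => norm_complexFrame hJ hJi (hu x hx) z)
    (fun x z h => eq_zero_of_complexFrame_eq_crossFrame hJ hJi he hfP h) (fun x hx => ?_)
    (fun g x z => ?_) (fun g x v hx hgx hgv hv hv0 => ?_)
  · rw [(WithLp.linearEquiv 2 ℝ (W × W)).finrank_eq, finrank_prod, finrank_euclideanSpace_fin]
    omega
  · simp [diagonalRepresentation_apply, WithLp.prod_inner_apply, hρ]
  · have h1 : ContDiffAt ℝ (⊤ : ℕ∞) u x :=
      ((hs.contDiffAt.norm ℝ (hs0 x (hx0 x hx))).inv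
        (norm_ne_zero_iff.mpr (hs0 x (hx0 x hx)))).smul hs.contDiffAt
    exact (contDiff_toContinuousLinearMap_apply (complexFrame J)).contDiffAt.comp x h1
  · simp [diagonalRepresentation_apply, complexFrame, huρ, hJρ]
  · have hs' : s x = ‖s x‖ • u x := by
      simp [u, smul_smul, mul_inv_cancel₀ (norm_ne_zero_iff.mpr (hs0 x (hx0 x hx)))]
    have h1 : ρ g v.fst = v.fst := congrArg WithLp.fst hgv
    have h2 : ρ g v.snd = v.snd := congrArg WithLp.snd hgv
    have h3 : ∀ i, ⟪v, complexFrame J (u x) (EuclideanSpace.single i 1)⟫_ℝ = 0 := fun i => hv _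
    simp only [complexFrame, LinearMap.mk₂_apply, WithLp.prod_inner_apply] at h3
    have h30 := h3 0
    have h31 := h3 1
    have h32 := h3 2
    have h33 := h3 3
    simp at h30 h31 h32 h33
    by_cases h0 : v.fst = 0
    · have h0' : v.snd ≠ 0 := by
        intro h0'
        exact hv0 (WithLp.ofLp_injective 2 (Prod.ext h0 h0'))
      refine hfree g x v.snd (hx0 x hx) hgx h2 ?_ ?_ h0'
      · rw [hs', inner_smul_right, h32, mul_zero]
      · rw [hs', map_smul, inner_smul_right, h33, mul_zero]
    · refine hfree g x v.fst (hx0 x hx) hgx h1 ?_ ?_ h0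
      · rw [hs', inner_smul_right, h30, mul_zero]
      · rw [hs', map_smul, inner_smul_right, h31, mul_zero]

end ComplexFrame

section Eigenvalues

open Matrix Polynomial
open scoped ComplexOrder

theorem eq_one_of_sub_one_pow_eq_zero {R : Type*} [Ring R] [Algebra ℂ R] {g : R} {n k : ℕ}
    (hn : n ≠ 0) (hg : g ^ n = 1) (hk : (g - 1) ^ (k + 1) = 0) : g = 1 := by
  have hcop : IsCoprime (X - C (1 : ℂ)) (∑ i ∈ Finset.range n, (X : ℂ[X]) ^ i) := by
    rw [(irreducible_X_sub_C (1 : ℂ)).coprime_iff_not_dvd, dvd_iff_isRoot]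
    simpa [eval_finsetSum] using hn
  obtain ⟨u, w, huw⟩ := hcop.pow_left (m := k)
  have h1 : X - C (1 : ℂ) = u * (X - C 1) ^ (k + 1) + w * (X ^ n - 1) := by
    rw [← geom_sum_mul, ← C_1]
    linear_combination (X - C (1 : ℂ)) * (-huw)
  have h2 := congrArg (aeval g) h1
  simp only [map_sub, map_add, map_mul, map_pow, aeval_X, map_one, hg, hk, sub_self,
    mul_zero, add_zero] at h2
  exact sub_eq_zero.mp h2

theorem exists_eigenvalues_of_fixes {g : Matrix (Fin 3) (Fin 3) ℂ} (hdet : g.det = 1)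
    {n : ℕ} (hn : Odd n) (hgn : g ^ n = 1) (hg : g ≠ 1) {v : Fin 3 → ℂ} (hv : v ≠ 0)
    (hgv : g *ᵥ v = v) :
    ∃ d : Fin 3 → ℂ, Function.Injective d ∧ ∀ i, ∃ w, w ≠ 0 ∧ g *ᵥ w = d i • w := by
  have hroot : ∀ r ∈ g.charpoly.roots, ∃ w, w ≠ 0 ∧ g *ᵥ w = r • w := by
    intro r hr
    have h1 : g.charpoly.IsRoot r := isRoot_of_mem_roots hr
    have h2 : (Matrix.scalar (Fin 3) r - g).det = 0 := by
      rw [← eval_charpoly]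
      exact h1
    obtain ⟨w, hw, hw'⟩ := exists_mulVec_eq_zero_iff.mpr h2
    refine ⟨w, hw, ?_⟩
    rw [sub_mulVec, sub_eq_zero] at hw'
    rw [← hw']
    simp [Matrix.scalar_apply, ← Matrix.smul_one_eq_diagonal, smul_mulVec]
  have hpow : ∀ r ∈ g.charpoly.roots, r ^ n = 1 := by
    intro r hr
    obtain ⟨w, hw, hgw⟩ := hroot r hr
    have h1 : ∀ k : ℕ, (g ^ k) *ᵥ w = r ^ k • w := by
      intro k
      induction k with
      | zero => simp
      | succ k ih => rw [pow_succ', ← mulVec_mulVec, ih, mulVec_smul, hgw, smul_smul, pow_succ]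
    have h2 := h1 n
    rw [hgn, one_mulVec] at h2
    have h3 : (r ^ n - 1) • w = 0 := by rw [sub_smul, one_smul, ← h2, sub_self]
    exact sub_eq_zero.mp ((smul_eq_zero.mp h3).resolve_right hw)
  have hone : (1 : ℂ) ∈ g.charpoly.roots := by
    rw [mem_roots g.charpoly_monic.ne_zero, IsRoot, eval_charpoly, ← exists_mulVec_eq_zero_iff]
    exact ⟨v, hv, by simp [sub_mulVec, hgv]⟩
  have hsplit : g.charpoly.Splits := IsAlgClosed.splits _
  have hcard : g.charpoly.roots.card = 3 := by
    rw [← hsplit.natDegree_eq_card_roots, charpoly_natDegree_eq_dim, Fintype.card_fin]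
  obtain ⟨T, hT⟩ := Multiset.exists_cons_of_mem hone
  obtain ⟨b, c, rfl⟩ : ∃ b c, T = {b, c} := by
    rw [hT, Multiset.card_cons] at hcard
    exact Multiset.card_eq_two.mp (by omega)
  have hbc : b * c = 1 := by
    have h1 := g.det_eq_prod_roots_charpoly
    rw [hT, hdet] at h1
    simpa using h1.symm
  have hb1 : b ≠ 1 := by
    rintro rfl
    rw [one_mul] at hbc
    subst hbc
    have h1 := g.aeval_self_charpoly
    rw [hsplit.eq_prod_roots_of_monic g.charpoly_monic, hT] at h1
    refine hg (eq_one_of_sub_one_pow_eq_zero (k := 2) hn.pos.ne' hgn ?_)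
    simpa [pow_succ, mul_assoc] using h1
  have hc1 : c ≠ 1 := by
    rintro rfl
    exact hb1 (by simpa using hbc)
  have hb_ne : b ≠ c := by
    rintro rfl
    have h1 : b ^ n = 1 := hpow b (by simp [hT])
    obtain ⟨k, rfl⟩ := hn
    rw [pow_add, pow_mul, sq, hbc, one_pow, one_mul, pow_one] at h1
    exact hb1 h1
  refine ⟨![1, b, c], ?_, fun i => ?_⟩
  · intro i j hij
    fin_cases i <;> fin_cases j <;> simp_all
  · refine hroot _ ?_
    rw [hT]
    fin_cases i <;> simp

theorem exists_diagonalization_of_injective_eigenvalues {m : Type*} [Fintype m] [DecidableEq m]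
    {K : Type*} [Field K] {g : Matrix m m K} {d : m → K} (hd : Function.Injective d)
    (h : ∀ i, ∃ w, w ≠ 0 ∧ g *ᵥ w = d i • w) :
    ∃ P : Matrix m m K, IsUnit P ∧ g * P = P * diagonal d := by
  choose w hw hgw using h
  refine ⟨Matrix.of fun i j => w j i, ?_, ?_⟩
  · rw [← linearIndependent_cols_iff_isUnit]
    exact Module.End.eigenvectors_linearIndependent' (Matrix.toLin' g) d hd w fun i => by
      rw [Module.End.hasEigenvector_iff, Module.End.mem_eigenspace_iff]
      exact ⟨by simpa using hgw i, hw i⟩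
  · ext i j
    rw [mul_diagonal]
    have h1 := congrFun (hgw j) i
    simpa [mul_comm, mulVec, dotProduct, mul_apply] using h1

theorem diagonal_of_commute_diagonal {m : Type*} [Fintype m] [DecidableEq m]
    {K : Type*} [Field K] {d : m → K} (hd : Function.Injective d) {Y : Matrix m m K}
    (hY : diagonal d * Y = Y * diagonal d) : Y = diagonal fun i => Y i i := by
  ext i j
  by_cases hij : i = j
  · simp [hij]
  · have h1 := congrFun (congrFun hY i) j
    rw [diagonal_mul, mul_diagonal, mul_comm, ← sub_eq_zero, ← mul_sub] at h1
    rw [diagonal_apply_ne _ hij]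
    exact (mul_eq_zero.mp h1).resolve_right (sub_ne_zero.mpr fun h => hij (hd h))

theorem im_eq_zero_of_isHermitian_mulVec_eq {m : Type*} [Fintype m] {A : Matrix m m ℂ}
    (hA : A.IsHermitian) {v : m → ℂ} (hv : v ≠ 0) {y : ℂ} (hy : A *ᵥ v = y • v) : y.im = 0 := by
  have h0 : star v ⬝ᵥ v ≠ 0 := by rwa [Ne, dotProduct_star_self_eq_zero]
  have h1 : star v ⬝ᵥ (A *ᵥ v) = y * (star v ⬝ᵥ v) := by rw [hy, dotProduct_smul, smul_eq_mul]
  have h2 : star (star v ⬝ᵥ (A *ᵥ v)) = star v ⬝ᵥ (A *ᵥ v) := by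
    rw [← star_dotProduct, star_mulVec, hA.eq, dotProduct_mulVec]
  have h3 : star (star v ⬝ᵥ v) = star v ⬝ᵥ v := (star_dotProduct v v).symm
  rw [h1, star_mul', h3] at h2
  exact Complex.conj_eq_iff_im.mp (mul_right_cancel₀ h0 h2)

end Eigenvalues

section TracelessHermitian

open Matrix
open scoped ComplexOrder

/-- The real vector space of traceless Hermitian `3 × 3` matrices. -/
def tracelessHermitian : Submodule ℝ (Matrix (Fin 3) (Fin 3) ℂ) where
  carrier := {X | Xᴴ = X ∧ X.trace = 0}
  zero_mem' := by simp
  add_mem' := by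
    rintro X Y ⟨hX, hX'⟩ ⟨hY, hY'⟩
    exact ⟨by rw [conjTranspose_add, hX, hY], by rw [trace_add, hX', hY', add_zero]⟩
  smul_mem' := by
    rintro r X ⟨hX, hX'⟩
    exact ⟨by rw [conjTranspose_smul, hX, star_trivial], by rw [trace_smul, hX', smul_zero]⟩

theorem mem_tracelessHermitian {X : Matrix (Fin 3) (Fin 3) ℂ} :
    X ∈ tracelessHermitian ↔ Xᴴ = X ∧ X.trace = 0 :=
  Iff.rfl

theorem finrank_tracelessHermitian : finrank ℝ tracelessHermitian = 8 := by
  let f : tracelessHermitian →ₗ[ℝ] (ℝ × ℝ) × ℂ × ℂ × ℂ :=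
    { toFun := fun X => (((X.1 0 0).re, (X.1 1 1).re), X.1 0 1, X.1 0 2, X.1 1 2)
      map_add' := fun X Y => by simp
      map_smul' := fun r X => by simp }
  have hf : Function.Bijective f := by
    constructor
    · rw [injective_iff_map_eq_zero]
      rintro ⟨X, hX, hX'⟩ h
      change (((X 0 0).re, (X 1 1).re), X 0 1, X 0 2, X 1 2) = 0 at h
      simp only [Prod.mk_eq_zero] at h
      obtain ⟨⟨h00, h11⟩, h01, h02, h12⟩ := h
      have hs : ∀ i j, star (X j i) = X i j := fun i j => congrFun (congrFun hX i) j
      have him : ∀ i, (X i i).im = 0 := fun i => Complex.conj_eq_iff_im.mp (hs i i)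
      have e00 : X 0 0 = 0 := Complex.ext h00 (him 0)
      have e11 : X 1 1 = 0 := Complex.ext h11 (him 1)
      have e22 : X 2 2 = 0 := by simpa [trace_fin_three, e00, e11] using hX'
      have e10 : X 1 0 = 0 := by rw [← hs, h01, star_zero]
      have e20 : X 2 0 = 0 := by rw [← hs, h02, star_zero]
      have e21 : X 2 1 = 0 := by rw [← hs, h12, star_zero]
      refine Subtype.ext (Matrix.ext fun i j => ?_)
      fin_cases i <;> fin_cases j <;> assumption
    · rintro ⟨⟨a, b⟩, z, u, w⟩
      refine ⟨⟨!![(a : ℂ), z, u; star z, b, w; star u, star w, -(a + b : ℂ)], ?_, ?_⟩, ?_⟩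
      · ext i j
        fin_cases i <;> fin_cases j <;> simp [conjTranspose_apply]
      · simp [trace_fin_three]
      · rfl
  rw [(LinearEquiv.ofBijective f hf).finrank_eq]
  simp

/-- The traceless Hermitian part of a matrix. -/
def tracelessHermitianPart : Matrix (Fin 3) (Fin 3) ℂ →ₗ[ℝ] tracelessHermitian where
  toFun X := ⟨(2⁻¹ : ℝ) • (X + Xᴴ) - (X.trace.re / 3 : ℝ) • 1, by
    rw [mem_tracelessHermitian]
    constructor
    · simp [add_comm]
    · rw [trace_sub, trace_smul, trace_smul, trace_add, trace_conjTranspose]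
      apply Complex.ext <;> simp
      ring⟩
  map_add' X Y := by
    refine Subtype.ext ?_
    simp only [conjTranspose_add, trace_add, Complex.add_re, Submodule.coe_add]
    module
  map_smul' r X := by
    refine Subtype.ext ?_
    simp only [conjTranspose_smul, trace_smul, Complex.real_smul, Complex.re_ofReal_mul,
      star_trivial, RingHom.id_apply, Submodule.coe_smul]
    module

theorem coe_tracelessHermitianPart (X : Matrix (Fin 3) (Fin 3) ℂ) :
    (tracelessHermitianPart X : Matrix (Fin 3) (Fin 3) ℂ) =
      (2⁻¹ : ℝ) • (X + Xᴴ) - (X.trace.re / 3 : ℝ) • 1 :=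
  rfl

theorem tracelessHermitianPart_mul_conjTranspose_ne_zero {A : Matrix (Fin 3) (Fin 2) ℂ}
    (hA : A ≠ 0) : tracelessHermitianPart (A * Aᴴ) ≠ 0 := by
  intro h
  have h1 := congrArg Subtype.val h
  rw [coe_tracelessHermitianPart, conjTranspose_mul, conjTranspose_conjTranspose,
    ZeroMemClass.coe_zero, sub_eq_zero] at h1
  obtain ⟨t, ht⟩ : ∃ t : ℝ, t = (A * Aᴴ).trace.re / 3 := ⟨_, rfl⟩
  rw [← ht] at h1
  have h2 : A * Aᴴ = (t : ℂ) • 1 := by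
    rw [Complex.coe_smul, ← h1]
    module
  have h3 : (A * Aᴴ).det = 0 := by
    by_contra hdet
    have h4 := rank_of_isUnit _ ((isUnit_iff_isUnit_det _).mpr (isUnit_iff_ne_zero.mpr hdet))
    have h5 := (rank_mul_le_left A Aᴴ).trans A.rank_le_width
    rw [Fintype.card_fin] at h4
    omega
  rw [h2, det_smul, det_one, mul_one, Fintype.card_fin, pow_eq_zero_iff three_ne_zero] at h3
  rw [h3, zero_smul, self_mul_conjTranspose_eq_zero] at h2
  exact hA h2

/-- The commutant of a nontrivial matrix of finite odd order and determinant one which fixes a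
vector is spanned, inside the traceless Hermitian matrices, by at most two elements. -/
theorem exists_linearMap_commutant {g : Matrix (Fin 3) (Fin 3) ℂ} (hdet : g.det = 1)
    {n : ℕ} (hn : Odd n) (hgn : g ^ n = 1) (hg : g ≠ 1) {A : Matrix (Fin 3) (Fin 2) ℂ}
    (hA : A ≠ 0) (hgA : g * A = A) :
    ∃ L : tracelessHermitian →ₗ[ℝ] ℝ × ℝ,
      ∀ X : tracelessHermitian, g * (X : Matrix (Fin 3) (Fin 3) ℂ) = X * g → L X = 0 → X = 0 := by
  obtain ⟨j, hj⟩ : ∃ j, (fun i => A i j) ≠ 0 := by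
    by_contra! h
    exact hA (Matrix.ext fun i j => congrFun (h j) i)
  have hgj : g *ᵥ (fun i => A i j) = fun i => A i j :=
    funext fun i => congrFun (congrFun hgA i) j
  obtain ⟨d, hd, hw⟩ := exists_eigenvalues_of_fixes hdet hn hgn hg hj hgj
  obtain ⟨P, hP, hgP⟩ := exists_diagonalization_of_injective_eigenvalues hd hw
  rw [isUnit_iff_isUnit_det] at hP
  let L : tracelessHermitian →ₗ[ℝ] ℝ × ℝ :=
    { toFun := fun X => (((P⁻¹ * X.1 * P) 0 0).re, ((P⁻¹ * X.1 * P) 1 1).re)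
      map_add' := fun X Y => by simp [mul_add, add_mul]
      map_smul' := fun r X => by simp }
  refine ⟨L, fun X hX hL => ?_⟩
  obtain ⟨Y, hY⟩ : ∃ Y, Y = P⁻¹ * X.1 * P := ⟨_, rfl⟩
  have hXY : X.1 * P = P * Y := by
    rw [hY, mul_assoc P⁻¹, mul_nonsing_inv_cancel_left _ _ hP]
  have hYd : diagonal d * Y = Y * diagonal d := by
    have h1 : P * (diagonal d * Y) = P * (Y * diagonal d) := by
      rw [← mul_assoc, ← hgP, mul_assoc, ← hXY, ← mul_assoc, hX, mul_assoc, hgP, ← mul_assoc,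
        hXY, mul_assoc]
    have h2 := congrArg (P⁻¹ * ·) h1
    simpa only [nonsing_inv_mul_cancel_left _ _ hP] using h2
  have hYdiag := diagonal_of_commute_diagonal hd hYd
  have him : ∀ i, (Y i i).im = 0 := by
    intro i
    refine im_eq_zero_of_isHermitian_mulVec_eq (v := fun k => P k i) X.2.1 ?_ ?_
    · intro h0
      have hdet0 : P.det = 0 := det_eq_zero_of_column_eq_zero i (congrFun h0)
      rw [hdet0] at hP
      exact not_isUnit_zero hP
    · funext k
      have h1 := congrFun (congrFun hXY k) i
      rw [hYdiag, mul_diagonal] at h1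
      change (X.1 * P) k i = Y i i * P k i
      rw [h1, mul_comm]
  have hL' : (Y 0 0).re = 0 ∧ (Y 1 1).re = 0 := by
    rw [hY]
    exact Prod.mk_eq_zero.mp hL
  have h00 : Y 0 0 = 0 := Complex.ext hL'.1 (him 0)
  have h11 : Y 1 1 = 0 := Complex.ext hL'.2 (him 1)
  have htr : Y.trace = 0 := by
    rw [hY, trace_mul_cycle, mul_nonsing_inv _ hP, one_mul, X.2.2]
  have h22 : Y 2 2 = 0 := by simpa [trace_fin_three, h00, h11] using htr
  have hY0 : Y = 0 := by
    rw [hYdiag, ← diagonal_zero]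
    congr 1
    funext i
    fin_cases i <;> assumption
  refine Subtype.ext ?_
  change X.1 = 0
  rw [hY0, mul_zero] at hXY
  have h1 := congrArg (· * P⁻¹) hXY
  simpa only [mul_nonsing_inv_cancel_right _ _ hP, zero_mul] using h1

end TracelessHermitian

section Frobenius

open Matrix

/-- A subspace of matrices, with the Frobenius norm, is isometric to a Euclidean space. -/
theorem exists_frobenius_linearEquiv {m n : Type*} [Fintype m] [Fintype n]
    (P : Submodule ℝ (Matrix m n ℂ)) {d : ℕ} (hd : finrank ℝ P = d) :
    ∃ ψ : EuclideanSpace ℝ (Fin d) ≃ₗ[ℝ] P,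
      ∀ x, ‖x‖ ^ 2 = ((ψ x : Matrix m n ℂ)ᴴ * (ψ x : Matrix m n ℂ)).trace.re := by
  let vec : Matrix m n ℂ ≃ₗ[ℝ] PiLp 2 (fun _ : m × n => ℂ) :=
    { toFun := fun A => WithLp.toLp 2 fun p => A p.1 p.2
      invFun := fun v => Matrix.of fun i j => v (i, j)
      map_add' := fun A B => rfl
      map_smul' := fun r A => rfl
      left_inv := fun A => rfl
      right_inv := fun v => rfl }
  have hvec : ∀ A, ‖vec A‖ ^ 2 = (Aᴴ * A).trace.re := by
    intro A
    rw [PiLp.norm_sq_eq_of_L2, Fintype.sum_prod_type, Finset.sum_comm]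
    simp only [trace, diag_apply, mul_apply, conjTranspose_apply, Complex.re_sum]
    refine Finset.sum_congr rfl fun j _ => Finset.sum_congr rfl fun i _ => ?_
    change ‖A i j‖ ^ 2 = _
    rw [← Complex.normSq_eq_norm_sq, Complex.normSq_apply]
    simp
  let Q : Submodule ℝ (PiLp 2 (fun _ : m × n => ℂ)) := P.map vec.toLinearMap
  let e : P ≃ₗ[ℝ] Q := vec.submoduleMap P
  have hQ : finrank ℝ Q = d := e.finrank_eq.symm.trans hd
  let b : OrthonormalBasis (Fin d) ℝ Q := (stdOrthonormalBasis ℝ Q).reindex (finCongr hQ)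
  refine ⟨b.repr.symm.toLinearEquiv.trans e.symm, fun x => ?_⟩
  rw [← hvec]
  have h1 : vec (e.symm (b.repr.symm x)) = ((b.repr.symm x : Q) : PiLp 2 (fun _ : m × n => ℂ)) :=
    congrArg Subtype.val (e.apply_symm_apply (b.repr.symm x))
  change _ = ‖vec (e.symm (b.repr.symm x))‖ ^ 2
  rw [h1]
  exact congrArg (· ^ 2) (b.repr.symm.norm_map x).symm

end Frobenius

section UnitaryAction

open Matrix

/-- The representation obtained by transport along a linear equivalence. -/
def conjRepresentation {G E F : Type*} [Group G] [AddCommGroup E] [Module ℝ E] [AddCommGroup F]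
    [Module ℝ F] (e : E ≃ₗ[ℝ] F) (π : Representation ℝ G F) : Representation ℝ G E where
  toFun g := e.symm.toLinearMap ∘ₗ π g ∘ₗ e.toLinearMap
  map_one' := by ext x; simp
  map_mul' g h := by ext x; simp

theorem apply_conjRepresentation {G E F : Type*} [Group G] [AddCommGroup E] [Module ℝ E]
    [AddCommGroup F] [Module ℝ F] (e : E ≃ₗ[ℝ] F) (π : Representation ℝ G F) (g : G) (x : E) :
    e (conjRepresentation e π g x) = π g (e x) :=
  e.apply_symm_apply _

theorem conjTranspose_mul_self_of_unitaryGroup (g : unitaryGroup (Fin 3) ℂ) :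
    (g : Matrix (Fin 3) (Fin 3) ℂ)ᴴ * (g : Matrix (Fin 3) (Fin 3) ℂ) = 1 :=
  UnitaryGroup.star_mul_self g

/-- Left multiplication of the unitary group on `3 × 2` matrices. -/
def leftMulRepresentation : Representation ℝ (unitaryGroup (Fin 3) ℂ) (Matrix (Fin 3) (Fin 2) ℂ)
    where
  toFun g :=
    { toFun := fun A => (g : Matrix (Fin 3) (Fin 3) ℂ) * A
      map_add' := Matrix.mul_add _
      map_smul' := fun _ _ => Matrix.mul_smul _ _ _ }
  map_one' := LinearMap.ext fun A => Matrix.one_mul A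
  map_mul' g h := LinearMap.ext fun A =>
    Matrix.mul_assoc (g : Matrix (Fin 3) (Fin 3) ℂ) (h : Matrix (Fin 3) (Fin 3) ℂ) A

/-- Conjugation action of the unitary group on traceless Hermitian matrices. -/
def conjugationRepresentation : Representation ℝ (unitaryGroup (Fin 3) ℂ) tracelessHermitian where
  toFun g :=
    { toFun := fun X => ⟨(g : Matrix (Fin 3) (Fin 3) ℂ) * X.1 * (g : Matrix (Fin 3) (Fin 3) ℂ)ᴴ, by
        rw [mem_tracelessHermitian]
        constructor
        · rw [conjTranspose_mul, conjTranspose_mul, conjTranspose_conjTranspose, X.2.1,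
            Matrix.mul_assoc]
        · rw [trace_mul_cycle, conjTranspose_mul_self_of_unitaryGroup, Matrix.one_mul, X.2.2]⟩
      map_add' := fun X Y => Subtype.ext (by simp [Matrix.mul_add, Matrix.add_mul])
      map_smul' := fun r X => Subtype.ext (by simp) }
  map_one' := LinearMap.ext fun X => Subtype.ext (by simp)
  map_mul' g h := LinearMap.ext fun X => Subtype.ext (by simp [Matrix.mul_assoc])

theorem coe_conjugationRepresentation (g : unitaryGroup (Fin 3) ℂ) (X : tracelessHermitian) :
    (conjugationRepresentation g X : Matrix (Fin 3) (Fin 3) ℂ) =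
      (g : Matrix (Fin 3) (Fin 3) ℂ) * X.1 * (g : Matrix (Fin 3) (Fin 3) ℂ)ᴴ :=
  rfl

theorem tracelessHermitianPart_leftMul (g : unitaryGroup (Fin 3) ℂ)
    (A : Matrix (Fin 3) (Fin 2) ℂ) :
    tracelessHermitianPart (leftMulRepresentation g A * (leftMulRepresentation g A)ᴴ) =
      conjugationRepresentation g (tracelessHermitianPart (A * Aᴴ)) := by
  have h1 : leftMulRepresentation g A * (leftMulRepresentation g A)ᴴ =
      (g : Matrix (Fin 3) (Fin 3) ℂ) * (A * Aᴴ) * (g : Matrix (Fin 3) (Fin 3) ℂ)ᴴ := by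
    change (g : Matrix (Fin 3) (Fin 3) ℂ) * A * ((g : Matrix (Fin 3) (Fin 3) ℂ) * A)ᴴ = _
    rw [conjTranspose_mul]
    simp only [Matrix.mul_assoc]
  have h2 : (g : Matrix (Fin 3) (Fin 3) ℂ) * (g : Matrix (Fin 3) (Fin 3) ℂ)ᴴ = 1 :=
    mul_eq_one_comm.mp (conjTranspose_mul_self_of_unitaryGroup g)
  refine Subtype.ext ?_
  rw [h1, coe_conjugationRepresentation, coe_tracelessHermitianPart, coe_tracelessHermitianPart,
    trace_mul_cycle, conjTranspose_mul_self_of_unitaryGroup, Matrix.one_mul]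
  simp only [conjTranspose_mul, conjTranspose_conjTranspose, Matrix.mul_sub, Matrix.sub_mul,
    Matrix.mul_smul, Matrix.smul_mul, Matrix.mul_add, Matrix.add_mul, Matrix.mul_one, h2,
    Matrix.mul_assoc]

theorem exists_linear_relation_of_finrank_lt {E F : Type*} [AddCommGroup E] [Module ℝ E]
    [AddCommGroup F] [Module ℝ F] [FiniteDimensional ℝ F] {k : ℕ} (hk : finrank ℝ F < k)
    (L : E →ₗ[ℝ] F) {v : Fin k → E} (hv : LinearIndependent ℝ v) :
    ∃ x ∈ Submodule.span ℝ (Set.range v), x ≠ 0 ∧ L x = 0 := by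
  by_contra! h
  have h1 : LinearIndependent ℝ (L ∘ v) := by
    refine hv.map ?_
    rw [Submodule.disjoint_def]
    intro x hx hx'
    by_contra hx0
    exact h x hx hx0 hx'
  have h2 := h1.fintype_card_le_finrank
  rw [Fintype.card_fin] at h2
  omega

/-- The quadratic map `x ↦ (φ x) (φ x)ᴴ`, made traceless, is smooth. -/
theorem contDiff_tracelessHermitianPart_mul_conjTranspose {E W : Type*} [NormedAddCommGroup E]
    [InnerProductSpace ℝ E] [FiniteDimensional ℝ E] [NormedAddCommGroup W]
    [InnerProductSpace ℝ W] [FiniteDimensional ℝ W]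
    (φ : E →ₗ[ℝ] Matrix (Fin 3) (Fin 2) ℂ) (ψ : tracelessHermitian →ₗ[ℝ] W) {n : WithTop ℕ∞} :
    ContDiff ℝ n fun x => ψ (tracelessHermitianPart (φ x * (φ x)ᴴ)) := by
  let b : E →ₗ[ℝ] E →ₗ[ℝ] W :=
    LinearMap.mk₂ ℝ (fun x y => ψ (tracelessHermitianPart (φ x * (φ y)ᴴ)))
      (fun x x' y => by simp [Matrix.add_mul])
      (fun r x y => by simp)
      (fun x y y' => by simp [Matrix.mul_add])
      (fun r x y => by simp)
  exact (contDiff_toContinuousLinearMap_apply b).clm_apply contDiff_id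

/-- Theorem B (specialized to subgroups of `SU(3)`): every finite odd-order subgroup of
`SU(3)` acts freely and smoothly on `S¹¹ × S¹¹`. -/
theorem odd_order_subgroup_of_SU3_acts_freely_smoothly_on_S11xS11
    (H : Subgroup (Matrix.unitaryGroup (Fin 3) ℂ))
    (hdet : ∀ g ∈ H, ((g : Matrix.unitaryGroup (Fin 3) ℂ) : Matrix (Fin 3) (Fin 3) ℂ).det = 1)
    (hodd : Odd (Nat.card H)) :
    ∃ ρ : H → Diffeomorph ((𝓡 11).prod (𝓡 11)) ((𝓡 11).prod (𝓡 11))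
        ((Metric.sphere (0 : EuclideanSpace ℝ (Fin 12)) 1) × (Metric.sphere (0 : EuclideanSpace ℝ (Fin 12)) 1))
        ((Metric.sphere (0 : EuclideanSpace ℝ (Fin 12)) 1) × (Metric.sphere (0 : EuclideanSpace ℝ (Fin 12)) 1)) (⊤ : ℕ∞),
      (∀ g h : H, ∀ x, ρ (g * h) x = ρ g (ρ h x)) ∧
      (∀ g : H, g ≠ 1 → ∀ x, ρ g x ≠ x) := by
  have : Finite H := Nat.finite_of_card_ne_zero hodd.pos.ne'
  have : Fintype H := Fintype.ofFinite H
  obtain ⟨ψ₁, hψ₁⟩ := exists_frobenius_linearEquiv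
    (⊤ : Submodule ℝ (Matrix (Fin 3) (Fin 2) ℂ)) (d := 12) (by
      rw [finrank_top, Module.finrank_matrix, Complex.finrank_real_complex]
      rfl)
  obtain ⟨ψ, hψ⟩ := exists_frobenius_linearEquiv tracelessHermitian finrank_tracelessHermitian
  let φ : EuclideanSpace ℝ (Fin 12) ≃ₗ[ℝ] Matrix (Fin 3) (Fin 2) ℂ := ψ₁.trans Submodule.topEquiv
  have hφ : ∀ x, ‖x‖ ^ 2 = ((φ x)ᴴ * φ x).trace.re := hψ₁
  let α : Representation ℝ H (EuclideanSpace ℝ (Fin 12)) :=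
    conjRepresentation φ (leftMulRepresentation.comp H.subtype)
  let ρ : Representation ℝ H (EuclideanSpace ℝ (Fin 8)) :=
    conjRepresentation ψ (conjugationRepresentation.comp H.subtype)
  have hφα : ∀ g x, φ (α g x) = leftMulRepresentation g.1 (φ x) :=
    apply_conjRepresentation φ (leftMulRepresentation.comp H.subtype)
  have hψρ : ∀ g x, ψ (ρ g x) = conjugationRepresentation g.1 (ψ x) :=
    apply_conjRepresentation ψ (conjugationRepresentation.comp H.subtype)
  have hα : ∀ g x, ‖α g x‖ = ‖x‖ := by
    intro g x
    rw [← sq_eq_sq₀ (norm_nonneg _) (norm_nonneg _), hφ, hφ, hφα]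
    change (((g.1 : Matrix (Fin 3) (Fin 3) ℂ) * φ x)ᴴ *
      ((g.1 : Matrix (Fin 3) (Fin 3) ℂ) * φ x)).trace.re = _
    rw [conjTranspose_mul, Matrix.mul_assoc, ← Matrix.mul_assoc _ _ (φ x),
      conjTranspose_mul_self_of_unitaryGroup, Matrix.one_mul]
  have hρn : ∀ g x, ‖ρ g x‖ = ‖x‖ := by
    intro g x
    have hg := conjTranspose_mul_self_of_unitaryGroup g.1
    have hsq : ∀ X : Matrix (Fin 3) (Fin 3) ℂ, g.1.1 * X * g.1.1ᴴ * (g.1.1 * X * g.1.1ᴴ) =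
        g.1.1 * (X * X) * g.1.1ᴴ := by
      intro X
      simp only [Matrix.mul_assoc]
      rw [← Matrix.mul_assoc g.1.1ᴴ g.1.1, hg, Matrix.one_mul]
    rw [← sq_eq_sq₀ (norm_nonneg _) (norm_nonneg _), hψ, hψ, hψρ, (ψ x).2.1,
      (conjugationRepresentation g.1 (ψ x)).2.1, coe_conjugationRepresentation, hsq,
      trace_mul_cycle, hg, Matrix.one_mul]
  have hρ : ∀ g x y, ⟪ρ g x, ρ g y⟫_ℝ = ⟪x, y⟫_ℝ := fun g x y =>
    (⟨ρ g, hρn g⟩ : EuclideanSpace ℝ (Fin 8) →ₗᵢ[ℝ] EuclideanSpace ℝ (Fin 8)).inner_map_map x y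
  obtain ⟨J, hJ, hJi, hJρ⟩ := exists_invariant_complexStructure hodd 8
    (EuclideanSpace ℝ (Fin 8)) ρ hρ finrank_euclideanSpace_fin (by decide)
  have hψ0 : ∀ x, x ≠ 0 → φ x ≠ 0 := fun x hx h => hx (φ.map_eq_zero_iff.mp h)
  refine exists_free_smooth_action_of_equivariant_map
    (by rw [finrank_euclideanSpace_fin, finrank_euclideanSpace_fin]) α hα ρ hρ hJ hJi hJρ
    (by rw [finrank_euclideanSpace_fin]; norm_num)
    (contDiff_tracelessHermitianPart_mul_conjTranspose φ.toLinearMap ψ.symm.toLinearMap)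
    (fun x hx h => ?_) (fun g x => ?_) (fun g x w hx hgx hgw hws hwJ hw => ?_)
  · exact tracelessHermitianPart_mul_conjTranspose_ne_zero (hψ0 x hx)
      (ψ.symm.map_eq_zero_iff.mp h)
  · apply ψ.injective
    rw [hψρ]
    simp only [LinearEquiv.coe_coe, LinearEquiv.apply_symm_apply, hφα,
      tracelessHermitianPart_leftMul]
  · by_contra hg1
    obtain ⟨s, hs⟩ : ∃ s, s = ψ.symm (tracelessHermitianPart (φ x * (φ x)ᴴ)) := ⟨_, rfl⟩
    have hs0 : s ≠ 0 := by
      rw [hs]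
      exact fun h => tracelessHermitianPart_mul_conjTranspose_ne_zero (hψ0 x hx)
        (ψ.symm.map_eq_zero_iff.mp h)
    change ⟪w, ψ.symm (tracelessHermitianPart (φ x * (φ x)ᴴ))⟫_ℝ = 0 at hws
    change ⟪w, J (ψ.symm (tracelessHermitianPart (φ x * (φ x)ᴴ)))⟫_ℝ = 0 at hwJ
    rw [← hs] at hws hwJ
    have hgs : ρ g s = s := by
      apply ψ.injective
      rw [hψρ, hs, ψ.apply_symm_apply, ← tracelessHermitianPart_leftMul, ← hφα, hgx]
    have hsJ := inner_map_self_eq_zero_of_sq_eq_neg hJ hJi s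
    have hJs0 : J s ≠ 0 := fun h => hs0 (by simpa [h] using hJ s)
    have hgφ : (g.1 : Matrix (Fin 3) (Fin 3) ℂ) * φ x = φ x := by
      have h1 := hφα g x
      rw [hgx] at h1
      exact h1.symm
    have hpow : (g.1 : Matrix (Fin 3) (Fin 3) ℂ) ^ Nat.card H = 1 := by
      have h1 : ((g ^ Nat.card H : H) : unitaryGroup (Fin 3) ℂ) = 1 := by
        rw [pow_card_eq_one']
        rfl
      exact congrArg Subtype.val h1
    obtain ⟨L, hL⟩ := exists_linearMap_commutant (hdet g.1 g.2) hodd hpow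
      (fun h => hg1 (Subtype.ext (Subtype.ext h))) (hψ0 x hx) hgφ
    have hli : LinearIndependent ℝ ![w, s, J s] := by
      refine linearIndependent_of_ne_zero_of_inner_eq_zero (𝕜 := ℝ) (fun i => ?_) fun i j hij => ?_
      · fin_cases i <;> assumption
      · fin_cases i <;> fin_cases j <;>
          first
            | exact absurd rfl hij
            | assumption
            | (rw [real_inner_comm]; assumption)
    obtain ⟨y, hy, hy0, hLy⟩ := exists_linear_relation_of_finrank_lt
      (by rw [finrank_prod, finrank_self]; norm_num) (L ∘ₗ ψ.toLinearMap) hli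
    have hgy : ρ g y = y := by
      have hle : Submodule.span ℝ (Set.range ![w, s, J s]) ≤
          LinearMap.eqLocus (ρ g) LinearMap.id := by
        rw [Submodule.span_le]
        rintro _ ⟨i, rfl⟩
        fin_cases i
        · exact hgw
        · exact hgs
        · exact (hJρ g s).symm.trans (congrArg J hgs)
      exact hle hy
    refine hy0 (ψ.map_eq_zero_iff.mp (hL (ψ y) ?_ hLy))
    have h1 := congrArg Subtype.val (hψρ g y)
    rw [hgy, coe_conjugationRepresentation] at h1
    have h2 := congrArg (· * (g.1 : Matrix (Fin 3) (Fin 3) ℂ)) h1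
    simp only [Matrix.mul_assoc, conjTranspose_mul_self_of_unitaryGroup, Matrix.mul_one] at h2
    exact h2.symm

end UnitaryAction
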